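/- Let m, n ∈ ℕ and, for each component index p ∈ {1,2}, let μ_{p1},…,μ_{pm} > 0, ν_{p1},…,ν_{pn} > 0, M_{p1},…,M_{pm} > 0, N_{p1},…,N_{pn} > 0 be real numbers, and set Υ_p = Σ_{j=1}^n N_{pj} − Σ_{i=1}^m M_{pi}. Define a_{pk} = (∏_{i=1}^m Γ(μ_{pi} + k·M_{pi})) / ((∏_{j=1}^n Γ(ν_{pj} + k·N_{pj})) · k!). Suppose Υ_1 > −1 and Υ_2 < −1. Then for every Z = (z_1, z_2) ∈ ℂ × ℂ with z_2 = 0 the series Σ_k (a_{1k} z_1^k, a_{2k} z_2^k) converges absolutely in both components, while for every Z with z_2 ≠ 0 the second component family (a_{2k} z_2^k)_k is not summable. -/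

import Mathlib

open scoped BigOperators

open Filter Topology

theorem Real.tendsto_log_add_mul_sub_log {M : ℝ} (hM : 0 < M) (c : ℝ) :
    Tendsto (fun k : ℕ => Real.log (c + k * M) - Real.log k) atTop (𝓝 (Real.log M)) := by
  have h1 : Tendsto (fun k : ℕ => c / (k : ℝ) + M) atTop (𝓝 M) := by
    simpa using (tendsto_const_div_atTop_nhds_zero_nat c).add_const M
  refine ((Real.continuousAt_log hM.ne').tendsto.comp h1).congr' ?_
  filter_upwards [eventually_gt_atTop 0, h1.eventually_const_lt hM] with k hk hpos
  have hk' : (0 : ℝ) < k := by exact_mod_cast hk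
  have e : c + k * M = k * (c / (k : ℝ) + M) := by field_simp
  rw [e, Real.log_mul hk'.ne' hpos.ne']
  simp

theorem Real.log_Gamma_add_one {x : ℝ} (hx : 0 < x) :
    Real.log (Real.Gamma (x + 1)) = Real.log x + Real.log (Real.Gamma x) := by
  rw [Real.Gamma_add_one hx.ne', Real.log_mul hx.ne' (Real.Gamma_pos_of_pos hx).ne']

/-- Log-convexity bounds an increment of `log Γ` from above. -/
theorem Real.log_Gamma_add_sub_le {x M : ℝ} (hx : 0 < x) (hM : 0 < M) :
    Real.log (Real.Gamma (x + M)) - Real.log (Real.Gamma x) ≤ M * Real.log (x + M) := by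
  have h := Real.convexOn_log_Gamma.slope_mono_adjacent (x := x) (y := x + M) (z := x + M + 1)
    (Set.mem_Ioi.2 hx) (Set.mem_Ioi.2 (by linarith)) (by linarith) (by linarith)
  simp only [Function.comp_apply] at h
  rw [Real.log_Gamma_add_one (by linarith : 0 < x + M)] at h
  rw [add_sub_cancel_left, add_sub_cancel_left, div_one, div_le_iff₀ hM] at h
  linarith

/-- Log-convexity bounds an increment of `log Γ` from below. -/
theorem Real.le_log_Gamma_add_sub {x M : ℝ} (hx : 1 < x) (hM : 0 < M) :
    M * Real.log (x - 1) ≤ Real.log (Real.Gamma (x + M)) - Real.log (Real.Gamma x) := by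
  have h := Real.convexOn_log_Gamma.slope_mono_adjacent (x := x - 1) (y := x) (z := x + M)
    (Set.mem_Ioi.2 (by linarith)) (Set.mem_Ioi.2 (by linarith)) (by linarith) (by linarith)
  simp only [Function.comp_apply] at h
  have h1 := Real.log_Gamma_add_one (by linarith : 0 < x - 1)
  rw [sub_add_cancel] at h1
  rw [h1, add_sub_cancel_left, sub_sub_cancel, div_one, le_div_iff₀ hM, add_sub_cancel_right] at h
  rw [h1]
  linarith

theorem Real.tendsto_log_Gamma_increment {M : ℝ} (hM : 0 < M) {μ : ℝ} (hμ : 0 < μ) :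
    Tendsto (fun k : ℕ => Real.log (Real.Gamma (μ + ((k + 1 : ℕ) : ℝ) * M)) -
      Real.log (Real.Gamma (μ + k * M)) - M * Real.log k) atTop (𝓝 (M * Real.log M)) := by
  have hlarge : ∀ᶠ k : ℕ in atTop, 1 < μ + k * M :=
    (tendsto_atTop_add_const_left _ μ
      (tendsto_natCast_atTop_atTop.atTop_mul_const hM)).eventually_gt_atTop 1
  refine tendsto_of_tendsto_of_tendsto_of_le_of_le'
    ((Real.tendsto_log_add_mul_sub_log hM (μ - 1)).const_mul M)
    ((Real.tendsto_log_add_mul_sub_log hM (μ + M)).const_mul M) ?_ ?_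
  · filter_upwards [hlarge] with k hk
    have h := Real.le_log_Gamma_add_sub hk hM
    have e1 : μ + k * M - 1 = μ - 1 + k * M := by ring
    have e2 : μ + k * M + M = μ + ((k + 1 : ℕ) : ℝ) * M := by push_cast; ring
    rw [e1, e2] at h
    linarith
  · filter_upwards with k
    have h := Real.log_Gamma_add_sub_le (x := μ + k * M) (by positivity) hM
    have e1 : μ + k * M + M = μ + M + k * M := by ring
    have e2 : μ + k * M + M = μ + ((k + 1 : ℕ) : ℝ) * M := by push_cast; ring
    rw [← e2]
    rw [← e1]
    linarith

/-- The coefficients of the Fox–Wright series. -/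
noncomputable def foxWrightCoeff {m n : ℕ} (μ M : Fin m → ℝ) (ν N : Fin n → ℝ) (k : ℕ) : ℝ :=
  (∏ i, Real.Gamma (μ i + (k : ℝ) * M i)) /
    ((∏ j, Real.Gamma (ν j + (k : ℝ) * N j)) * (Nat.factorial k : ℝ))

section FoxWright

variable {m n : ℕ} {μ M : Fin m → ℝ} {ν N : Fin n → ℝ}

theorem foxWrightCoeff_pos (hμ : ∀ i, 0 < μ i) (hν : ∀ j, 0 < ν j) (hM : ∀ i, 0 < M i)
    (hN : ∀ j, 0 < N j) (k : ℕ) : 0 < foxWrightCoeff μ M ν N k := by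
  have h1 : ∀ i, 0 < Real.Gamma (μ i + (k : ℝ) * M i) := fun i =>
    Real.Gamma_pos_of_pos (add_pos_of_pos_of_nonneg (hμ i) (mul_nonneg k.cast_nonneg (hM i).le))
  have h2 : ∀ j, 0 < Real.Gamma (ν j + (k : ℝ) * N j) := fun j =>
    Real.Gamma_pos_of_pos (add_pos_of_pos_of_nonneg (hν j) (mul_nonneg k.cast_nonneg (hN j).le))
  exact div_pos (Finset.prod_pos fun i _ => h1 i)
    (mul_pos (Finset.prod_pos fun j _ => h2 j) (by positivity))

theorem log_foxWrightCoeff (hμ : ∀ i, 0 < μ i) (hν : ∀ j, 0 < ν j) (hM : ∀ i, 0 < M i)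
    (hN : ∀ j, 0 < N j) (k : ℕ) :
    Real.log (foxWrightCoeff μ M ν N k) = ∑ i, Real.log (Real.Gamma (μ i + (k : ℝ) * M i)) -
      (∑ j, Real.log (Real.Gamma (ν j + (k : ℝ) * N j)) +
        Real.log (Real.Gamma (1 + (k : ℝ) * 1))) := by
  have h1 : ∀ i, Real.Gamma (μ i + (k : ℝ) * M i) ≠ 0 := fun i =>
    (Real.Gamma_pos_of_pos
      (add_pos_of_pos_of_nonneg (hμ i) (mul_nonneg k.cast_nonneg (hM i).le))).ne'
  have h2 : ∀ j, Real.Gamma (ν j + (k : ℝ) * N j) ≠ 0 := fun j =>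
    (Real.Gamma_pos_of_pos
      (add_pos_of_pos_of_nonneg (hν j) (mul_nonneg k.cast_nonneg (hN j).le))).ne'
  have h3 : ∏ i, Real.Gamma (μ i + (k : ℝ) * M i) ≠ 0 := Finset.prod_ne_zero_iff.2 fun i _ => h1 i
  have h4 : ∏ j, Real.Gamma (ν j + (k : ℝ) * N j) ≠ 0 := Finset.prod_ne_zero_iff.2 fun j _ => h2 j
  have h5 : (Nat.factorial k : ℝ) ≠ 0 := by positivity
  rw [foxWrightCoeff, Real.log_div h3 (mul_ne_zero h4 h5), Real.log_mul h4 h5,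
    Real.log_prod fun i _ => h1 i, Real.log_prod fun j _ => h2 j,
    mul_one, add_comm (1 : ℝ) (k : ℝ), Real.Gamma_nat_eq_factorial]

theorem tendsto_log_foxWrightCoeff_increment (hμ : ∀ i, 0 < μ i) (hν : ∀ j, 0 < ν j)
    (hM : ∀ i, 0 < M i) (hN : ∀ j, 0 < N j) :
    Tendsto (fun k : ℕ => Real.log (foxWrightCoeff μ M ν N (k + 1)) -
        Real.log (foxWrightCoeff μ M ν N k) + (∑ j, N j - ∑ i, M i + 1) * Real.log k) atTop
      (𝓝 (∑ i, M i * Real.log (M i) - (∑ j, N j * Real.log (N j) + 1 * Real.log 1))) := by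
  have hA := tendsto_finsetSum Finset.univ
    fun i (_ : i ∈ Finset.univ) => Real.tendsto_log_Gamma_increment (hM i) (hμ i)
  have hB := tendsto_finsetSum Finset.univ
    fun j (_ : j ∈ Finset.univ) => Real.tendsto_log_Gamma_increment (hN j) (hν j)
  refine (hA.sub (hB.add (Real.tendsto_log_Gamma_increment one_pos one_pos))).congr fun k => ?_
  rw [log_foxWrightCoeff hμ hν hM hN, log_foxWrightCoeff hμ hν hM hN]
  simp only [Finset.sum_sub_distrib, ← Finset.sum_mul]
  ring

theorem tendsto_log_foxWrightCoeff_increment_atBot (hμ : ∀ i, 0 < μ i) (hν : ∀ j, 0 < ν j)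
    (hM : ∀ i, 0 < M i) (hN : ∀ j, 0 < N j) (hΥ : -1 < ∑ j, N j - ∑ i, M i) :
    Tendsto (fun k : ℕ => Real.log (foxWrightCoeff μ M ν N (k + 1)) -
      Real.log (foxWrightCoeff μ M ν N k)) atTop atBot := by
  have hlog : Tendsto (fun k : ℕ => Real.log k) atTop atTop :=
    Real.tendsto_log_atTop.comp tendsto_natCast_atTop_atTop
  refine ((tendsto_log_foxWrightCoeff_increment hμ hν hM hN).add_atBot
    (hlog.const_mul_atTop_of_neg
      (by linarith : -(∑ j, N j - ∑ i, M i + 1) < 0))).congr fun k => ?_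
  ring

theorem tendsto_log_foxWrightCoeff_increment_atTop (hμ : ∀ i, 0 < μ i) (hν : ∀ j, 0 < ν j)
    (hM : ∀ i, 0 < M i) (hN : ∀ j, 0 < N j) (hΥ : ∑ j, N j - ∑ i, M i < -1) :
    Tendsto (fun k : ℕ => Real.log (foxWrightCoeff μ M ν N (k + 1)) -
      Real.log (foxWrightCoeff μ M ν N k)) atTop atTop := by
  have hlog : Tendsto (fun k : ℕ => Real.log k) atTop atTop :=
    Real.tendsto_log_atTop.comp tendsto_natCast_atTop_atTop
  refine ((tendsto_log_foxWrightCoeff_increment hμ hν hM hN).add_atTop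
    (hlog.const_mul_atTop
      (by linarith : 0 < -(∑ j, N j - ∑ i, M i + 1)))).congr fun k => ?_
  ring

end FoxWright

theorem summable_mul_pow_of_log_increment_atBot {a : ℕ → ℝ} (ha : ∀ k, 0 < a k)
    (h : Tendsto (fun k => Real.log (a (k + 1)) - Real.log (a k)) atTop atBot) (z : ℂ) :
    Summable fun k : ℕ => (a k : ℂ) * z ^ k := by
  have hc : 0 < 1 / (2 * (‖z‖ + 1)) := by positivity
  refine summable_of_ratio_norm_eventually_le (r := 1 / 2) (by norm_num) ?_
  filter_upwards [h.eventually_le_atBot (Real.log (1 / (2 * (‖z‖ + 1))))] with k hk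
  rw [← Real.log_div (ha _).ne' (ha _).ne', Real.log_le_log_iff (div_pos (ha _) (ha _)) hc,
    div_le_div_iff₀ (ha k) (by positivity)] at hk
  have h1 : a (k + 1) * ‖z‖ ≤ 1 / 2 * a k := by nlinarith [ha (k + 1)]
  simp only [norm_mul, norm_pow, Complex.norm_real, Real.norm_of_nonneg (ha _).le]
  calc a (k + 1) * ‖z‖ ^ (k + 1) = a (k + 1) * ‖z‖ * ‖z‖ ^ k := by ring
    _ ≤ 1 / 2 * a k * ‖z‖ ^ k := by gcongr
    _ = 1 / 2 * (a k * ‖z‖ ^ k) := by ring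

theorem not_summable_mul_pow_of_log_increment_atTop {a : ℕ → ℝ} (ha : ∀ k, 0 < a k)
    (h : Tendsto (fun k => Real.log (a (k + 1)) - Real.log (a k)) atTop atTop) {z : ℂ}
    (hz : z ≠ 0) : ¬ Summable fun k : ℕ => (a k : ℂ) * z ^ k := by
  have hz' : 0 < ‖z‖ := norm_pos_iff.2 hz
  have hc : 0 < 2 / ‖z‖ := by positivity
  refine not_summable_of_ratio_norm_eventually_ge (r := 2) (by norm_num)
    (Frequently.of_forall fun k => ?_) ?_
  · exact norm_ne_zero_iff.2
      (mul_ne_zero (Complex.ofReal_ne_zero.2 (ha k).ne') (pow_ne_zero k hz))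
  filter_upwards [h.eventually_ge_atTop (Real.log (2 / ‖z‖))] with k hk
  rw [← Real.log_div (ha _).ne' (ha _).ne', Real.log_le_log_iff hc (div_pos (ha _) (ha _)),
    div_le_div_iff₀ hz' (ha k)] at hk
  simp only [norm_mul, norm_pow, Complex.norm_real, Real.norm_of_nonneg (ha _).le]
  calc 2 * (a k * ‖z‖ ^ k) = 2 * a k * ‖z‖ ^ k := by ring
    _ ≤ a (k + 1) * ‖z‖ * ‖z‖ ^ k := by gcongr
    _ = a (k + 1) * ‖z‖ ^ (k + 1) := by ring

/-- Bicomplex Fox–Wright series in idempotent coordinates with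
Υ₁ > −1 and Υ₂ < −1: for Z = (z₁, z₂) with z₂ = 0 both component families are
summable, while for z₂ ≠ 0 the second component family is not summable. -/
theorem bicomplexFoxWright_mixed_case
    (m n : ℕ) (μ M : Fin 2 → Fin m → ℝ) (ν N : Fin 2 → Fin n → ℝ)
    (hμ : ∀ p i, 0 < μ p i) (hν : ∀ p j, 0 < ν p j)
    (hM : ∀ p i, 0 < M p i) (hN : ∀ p j, 0 < N p j)
    (a : Fin 2 → ℕ → ℝ)
    (ha : ∀ p (k : ℕ), a p k =
      (∏ i, Real.Gamma (μ p i + (k : ℝ) * M p i)) /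
        ((∏ j, Real.Gamma (ν p j + (k : ℝ) * N p j)) * (Nat.factorial k : ℝ)))
    (hΥ₁ : -1 < (∑ j, N 0 j) - (∑ i, M 0 i))
    (hΥ₂ : (∑ j, N 1 j) - (∑ i, M 1 i) < -1) :
    ∀ z : Fin 2 → ℂ,
      (z 1 = 0 →
        (Summable fun k : ℕ => (a 0 k : ℂ) * z 0 ^ k) ∧
        (Summable fun k : ℕ => (a 1 k : ℂ) * z 1 ^ k)) ∧
      (z 1 ≠ 0 → ¬ Summable fun k : ℕ => (a 1 k : ℂ) * z 1 ^ k) := by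
  have hcoeff : ∀ p, a p = foxWrightCoeff (μ p) (M p) (ν p) (N p) := fun p => funext (ha p)
  have hpos : ∀ p k, 0 < a p k := fun p k => by
    rw [hcoeff]
    exact foxWrightCoeff_pos (hμ p) (hν p) (hM p) (hN p) k
  refine fun z => ⟨fun hz => ⟨?_, ?_⟩, fun hz => ?_⟩
  · refine summable_mul_pow_of_log_increment_atBot (hpos 0) ?_ (z 0)
    rw [hcoeff]
    exact tendsto_log_foxWrightCoeff_increment_atBot (hμ 0) (hν 0) (hM 0) (hN 0) hΥ₁
  · refine summable_of_ne_finset_zero (s := {0}) fun k hk => ?_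
    rw [hz, zero_pow (by simpa using hk), mul_zero]
  · refine not_summable_mul_pow_of_log_increment_atTop (hpos 1) ?_ hz
    rw [hcoeff]
    exact tendsto_log_foxWrightCoeff_increment_atTop (hμ 1) (hν 1) (hM 1) (hN 1) hΥ₂
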